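/- There is a universal constant c > 0 with the following property. Let n ≥ 1 be an integer, H > 0, ε ∈ (0,1), let 𝒳 be a collection of subsets of {1,…,n} with ∅ ∈ 𝒳, and let F = F₁ ⊗ … ⊗ F_n be a product probability measure on ℝⁿ whose marginals F_i are atomless and supported in [0,H]. Then for every integer t ≥ c·H·n²/ε there exist a nondecreasing vector Φ ∈ ℝᵗ, a strict total order on 𝒳, and thresholds defining a t-level auction A for 𝒳 such that E_{v∼F}[Rev_A(v)] ≥ OPT_𝒳(F) − ε. -/

import Mathlib

open MeasureTheory
open scoped ENNReal

attribute [local instance] Classical.propDecidable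

/-- A `t`-level auction's thresholds for `n` bidders: nondecreasing thresholds
`thr i 0 ≤ thr i 1 ≤ … ≤ thr i (t-1)` for each bidder `i`. -/
structure TLevel (n t : ℕ) where
  thr : Fin n → Fin t → ℝ
  mono : ∀ i, Monotone (thr i)

/-- The number of thresholds of bidder `i` met by bid `b`.  Since the thresholds are
nondecreasing, bidder `i`'s level is this count minus one (and `-1`, i.e. count `0`,
means no threshold is met). -/
noncomputable def levCount {n t : ℕ} (A : TLevel n t) (i : Fin n) (b : ℝ) : ℕ :=
  (Finset.univ.filter fun τ : Fin t => A.thr i τ ≤ b).card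

/-- The estimate `Φ_τ` attached to a bidder whose met-threshold count is `c`
(i.e. whose level is `τ = c - 1`); junk value `0` out of range. -/
noncomputable def phiAt {t : ℕ} (Φ : Fin t → ℝ) (c : ℕ) : ℝ :=
  if h : c - 1 < t then Φ ⟨c - 1, h⟩ else 0

/-- `e_X(v) = Σ_{i ∈ X} Φ_{t_i(v_i)}`: the estimated virtual value of the feasible
set `X` at profile `v`. -/
noncomputable def eSet {n t : ℕ} (A : TLevel n t) (Φ : Fin t → ℝ)
    (v : Fin n → ℝ) (X : Finset (Fin n)) : ℝ :=
  ∑ i ∈ X, phiAt Φ (levCount A i (v i))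

/-- The set selected by the `t`-level auction for the feasibility system `𝒳` with
estimates `Φ` and tie-breaking order `ord` on `𝒳`: if some bidder has level `-1`,
select `∅`; otherwise select the member of `𝒳` maximizing `e_X(v)`, ties broken
by `ord`. -/
noncomputable def selected {n t : ℕ} (A : TLevel n t) (Φ : Fin t → ℝ)
    (𝒳 : Finset (Finset (Fin n))) (ord : Finset (Fin n) → Finset (Fin n) → Prop)
    (v : Fin n → ℝ) : Finset (Fin n) :=
  if ∃ i, levCount A i (v i) = 0 then ∅
  else if h : ∃ X, X ∈ 𝒳 ∧ ∀ Y ∈ 𝒳, Y ≠ X →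
      (eSet A Φ v Y < eSet A Φ v X ∨ (eSet A Φ v Y = eSet A Φ v X ∧ ord X Y)) then
    h.choose
  else ∅

/-- The payment of a selected bidder `i`: the infimum over bids at which `i` would
still belong to the selected set (unselected bidders pay 0 in `RevX` below). -/
noncomputable def payX {n t : ℕ} (A : TLevel n t) (Φ : Fin t → ℝ)
    (𝒳 : Finset (Finset (Fin n))) (ord : Finset (Fin n) → Finset (Fin n) → Prop)
    (v : Fin n → ℝ) (i : Fin n) : ℝ :=
  sInf {b : ℝ | i ∈ selected A Φ 𝒳 ord (Function.update v i b)}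

/-- The revenue of the `t`-level auction for `𝒳` on profile `v`: the sum of the
selected bidders' critical payments. -/
noncomputable def RevX {n t : ℕ} (A : TLevel n t) (Φ : Fin t → ℝ)
    (𝒳 : Finset (Finset (Fin n))) (ord : Finset (Fin n) → Finset (Fin n) → Prop)
    (v : Fin n → ℝ) : ℝ :=
  ∑ i ∈ selected A Φ 𝒳 ord v, payX A Φ 𝒳 ord v i

/-- `ord` is a strict total order on the members of `𝒳`. -/
def StrictTotalOn {n : ℕ} (𝒳 : Finset (Finset (Fin n)))
    (ord : Finset (Fin n) → Finset (Fin n) → Prop) : Prop :=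
  (∀ X ∈ 𝒳, ¬ ord X X) ∧
  (∀ X ∈ 𝒳, ∀ Y ∈ 𝒳, ∀ Z ∈ 𝒳, ord X Y → ord Y Z → ord X Z) ∧
  (∀ X ∈ 𝒳, ∀ Y ∈ 𝒳, X ≠ Y → ord X Y ∨ ord Y X)

/-- A deterministic DSIC-IR auction for the feasibility system `𝒳` with valuations in
`V`: a measurable allocation rule choosing a feasible set, and measurable nonnegative
payments bounded by value times allocation, such that truthful bidding is a dominant
strategy. -/
structure XDSICAuction (n : ℕ) (𝒳 : Finset (Finset (Fin n))) (V : Set ℝ) where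
  choice : (Fin n → ℝ) → Finset (Fin n)
  pay : (Fin n → ℝ) → Fin n → ℝ
  choice_mem : ∀ v, choice v ∈ 𝒳
  choice_meas : ∀ X : Finset (Fin n), MeasurableSet {v | choice v = X}
  pay_meas : ∀ i, Measurable fun v => pay v i
  pay_nonneg : ∀ v i, 0 ≤ pay v i
  pay_le : ∀ v, (∀ j, v j ∈ V) → ∀ i,
    pay v i ≤ v i * (if i ∈ choice v then 1 else 0)
  dsic : ∀ v : Fin n → ℝ, (∀ j, v j ∈ V) → ∀ (i : Fin n) (b : ℝ), b ∈ V →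
    v i * (if i ∈ choice (Function.update v i b) then 1 else 0) -
        pay (Function.update v i b) i ≤
      v i * (if i ∈ choice v then 1 else 0) - pay v i

/-- `OPTX n 𝒳 V F`: the supremum of expected revenue over all DSIC-IR auctions for
the feasibility system `𝒳` with valuations in `V`, for bid distribution `F`. -/
noncomputable def OPTX (n : ℕ) (𝒳 : Finset (Finset (Fin n))) (V : Set ℝ)
    (F : Measure (Fin n → ℝ)) : ℝ≥0∞ :=
  ⨆ A : XDSICAuction n 𝒳 V, ∫⁻ v, ∑ i, ENNReal.ofReal (A.pay v i) ∂F

/-- A continuous function on `[0, H]` has a greatest maximizer. -/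
theorem exists_greatest_maximizer {f : ℝ → ℝ} (hf : Continuous f) {H : ℝ} (hH : 0 ≤ H) :
    ∃ x ∈ Set.Icc 0 H, (∀ y ∈ Set.Icc 0 H, f y ≤ f x) ∧
      ∀ y ∈ Set.Icc 0 H, x < y → f y < f x := by
  obtain ⟨z, hz, hmax⟩ := isCompact_Icc.exists_isMaxOn
    (Set.nonempty_Icc.2 hH) (hf.continuousOn (s := Set.Icc 0 H))
  have hcomp : IsCompact (Set.Icc 0 H ∩ {x | f z ≤ f x}) :=
    isCompact_Icc.inter_right (isClosed_le continuous_const hf)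
  obtain ⟨x, hx, hgr⟩ := hcomp.exists_isGreatest ⟨z, hz, le_refl (f z)⟩
  have hle : ∀ y ∈ Set.Icc 0 H, f y ≤ f x := fun y hy => (hmax hy).trans hx.2
  refine ⟨x, hx.1, hle, fun y hy hxy => lt_of_le_of_ne (hle y hy) fun h => ?_⟩
  exact absurd (hgr ⟨hy, show f z ≤ f y from h ▸ hx.2⟩) (not_le.2 hxy)

/-- Optimal posted prices against the increasing costs `a + k * δ` for a demand curve `G`.
At these prices the revenue `p * G p` dominates the demand-weighted sum of the costs, and
at every price it is at most that sum plus `δ * G p`. -/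
theorem exists_price_ladder {G : ℝ → ℝ} (hc : Continuous G) (ha : Antitone G)
    (h0 : ∀ x, 0 ≤ G x) {H δ a : ℝ} (hδ : 0 ≤ δ) (hH : 0 ≤ H) {m : ℕ} (hm : 1 ≤ m)
    (ham : a + m * δ = H) :
    ∃ L : ℕ → ℝ, Monotone L ∧ (∀ k, L k ∈ Set.Icc 0 H) ∧
      (∀ j ≤ m, a * G (L j) + δ * ∑ k ∈ Finset.Ioc 0 m, G (max (L j) (L k)) ≤
        L j * G (L j)) ∧
      (∀ p ≤ H, 0 ≤ p →
        p * G p ≤ (a + δ) * G p + δ * ∑ k ∈ Finset.Ioc 0 m, G (max p (L k))) := by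
  have hex : ∀ k : ℕ, ∃ x ∈ Set.Icc 0 H,
      (∀ y ∈ Set.Icc 0 H, (y - (a + k * δ)) * G y ≤ (x - (a + k * δ)) * G x) ∧
      ∀ y ∈ Set.Icc 0 H, x < y → (y - (a + k * δ)) * G y < (x - (a + k * δ)) * G x :=
    fun k => exists_greatest_maximizer (f := fun y => (y - (a + k * δ)) * G y)
      (by fun_prop) hH
  choose L hL hmax hgr using hex
  have hmono : Monotone L := by
    refine monotone_nat_of_le_succ fun k => ?_
    by_contra! hlt
    have h1 := hgr (k + 1) (L k) (hL k) hlt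
    have h2 := hmax k (L (k + 1)) (hL _)
    have h3 := ha hlt.le
    push_cast at h1
    nlinarith [mul_nonneg hδ (sub_nonneg.2 h3)]
  have hLm : L m = H := by
    refine le_antisymm (hL m).2 ?_
    by_contra! hlt
    have h1 := hgr m H ⟨hH, le_rfl⟩ hlt
    rw [ham] at h1
    nlinarith [h0 (L m)]
  have low : ∀ j ≤ m, δ * ∑ k ∈ Finset.Ioc j m, G (L k) ≤
      (L j - (a + j * δ)) * G (L j) := by
    intro j hj
    induction hj using Nat.decreasingInduction with
    | self => simp [ham, hLm]
    | of_succ j hj ih =>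
      rw [← Finset.sum_Ioc_consecutive _ (Nat.le_succ j) (Nat.succ_le_of_lt hj)]
      have h1 := hmax j (L (j + 1)) (hL _)
      simp only [Nat.succ_eq_add_one, Nat.Ioc_succ_singleton, Finset.sum_singleton]
      push_cast at ih
      nlinarith
  have up : ∀ j ≤ m, (L (j + 1) - (a + (j + 1 : ℕ) * δ)) * G (L (j + 1)) ≤
      δ * ∑ k ∈ Finset.Ioc j m, G (L k) := by
    intro j hj
    induction hj using Nat.decreasingInduction with
    | self =>
      simp only [Finset.Ioc_self, Finset.sum_empty, mul_zero]
      refine mul_nonpos_of_nonpos_of_nonneg ?_ (h0 _)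
      push_cast
      linarith [(hL (m + 1)).2]
    | of_succ j hj ih =>
      rw [← Finset.sum_Ioc_consecutive _ (Nat.le_succ j) (Nat.succ_le_of_lt hj)]
      have h1 := hmax (j + 1 + 1) (L (j + 1)) (hL _)
      simp only [Nat.succ_eq_add_one, Nat.Ioc_succ_singleton, Finset.sum_singleton]
      push_cast at ih h1 ⊢
      nlinarith
  refine ⟨L, hmono, hL, fun j hj => ?_, fun p hp hp0 => ?_⟩
  · rw [← Finset.sum_Ioc_consecutive _ (Nat.zero_le j) hj]
    have e1 : ∑ k ∈ Finset.Ioc 0 j, G (max (L j) (L k)) = j * G (L j) := by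
      rw [Finset.sum_congr rfl fun k hk => by
        rw [max_eq_left (hmono (Finset.mem_Ioc.1 hk).2)]]
      simp
    have e2 : ∑ k ∈ Finset.Ioc j m, G (max (L j) (L k)) = ∑ k ∈ Finset.Ioc j m, G (L k) :=
      Finset.sum_congr rfl fun k hk => by
        rw [max_eq_right (hmono (Finset.mem_Ioc.1 hk).1.le)]
    rw [e1, e2]
    nlinarith [low j hj]
  · have hexj : ∃ j, p ≤ L (j + 1) := ⟨m - 1, by rw [Nat.sub_add_cancel hm, hLm]; exact hp⟩
    set j := Nat.find hexj
    have hj : p ≤ L (j + 1) := Nat.find_spec hexj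
    have hjm : j ≤ m := (Nat.find_min' hexj
      (by rw [Nat.sub_add_cancel hm, hLm]; exact hp)).trans (Nat.sub_le m 1)
    rw [← Finset.sum_Ioc_consecutive _ (Nat.zero_le j) hjm]
    have e1 : ∑ k ∈ Finset.Ioc 0 j, G (max p (L k)) = j * G p := by
      refine (Finset.sum_congr rfl fun k hk => ?_).trans
        (by simp : ∑ k ∈ Finset.Ioc 0 j, G p = j * G p)
      obtain ⟨hk0, hkj⟩ := Finset.mem_Ioc.1 hk
      have := Nat.find_min hexj (m := k - 1) (by omega)
      rw [Nat.sub_add_cancel hk0, not_le] at this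
      rw [max_eq_left this.le]
    have e2 : ∑ k ∈ Finset.Ioc j m, G (max p (L k)) = ∑ k ∈ Finset.Ioc j m, G (L k) :=
      Finset.sum_congr rfl fun k hk => by
        rw [max_eq_right (hj.trans (hmono (Finset.mem_Ioc.1 hk).1))]
    rw [e1, e2]
    have h1 := up j hjm
    have h2 := hmax (j + 1) p ⟨hp0, hp⟩
    push_cast at h1 h2
    nlinarith

theorem continuous_measureReal_Ici (μ : Measure ℝ) [IsProbabilityMeasure μ] [NullSingletonClass μ] :
    Continuous fun p => μ.real (Set.Ici p) := by
  have h : (fun p => μ.real (Set.Ici p)) =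
      fun p => ∫ b, (Set.Ici p).indicator (fun _ => (1 : ℝ)) b ∂μ := by
    funext p
    rw [integral_indicator measurableSet_Ici]
    simp
  rw [h, continuous_iff_continuousAt]
  intro p
  refine continuousAt_of_dominated (bound := fun _ => 1) ?_ ?_ (integrable_const _) ?_
  · exact Filter.Eventually.of_forall fun q =>
      (measurable_const.indicator measurableSet_Ici).aestronglyMeasurable
  · refine Filter.Eventually.of_forall fun q => Filter.Eventually.of_forall fun b => ?_
    by_cases hb : b ∈ Set.Ici q <;> simp [Set.indicator, hb]
  · have hne : ∀ᵐ b ∂μ, b ≠ p := by simp [ae_iff]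
    filter_upwards [hne] with b hb
    rcases lt_or_gt_of_ne hb with hb | hb
    · refine (continuousAt_const (y := (0 : ℝ))).congr ?_
      filter_upwards [lt_mem_nhds hb] with q hq
      simp [Set.indicator, hq]
    · refine (continuousAt_const (y := (1 : ℝ))).congr ?_
      filter_upwards [gt_mem_nhds hb] with q hq
      simp [Set.indicator, hq.le]

/-- Resampling one coordinate preserves a product measure. -/
theorem measurePreserving_update_pi {ι : Type*} [Fintype ι] [DecidableEq ι]
    (μ : ι → Measure ℝ) [∀ i, IsProbabilityMeasure (μ i)] (i : ι) :
    MeasurePreserving (fun z : (ι → ℝ) × ℝ => Function.update z.1 i z.2)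
      ((Measure.pi μ).prod (μ i)) (Measure.pi μ) := by
  have hmeas : Measurable fun z : (ι → ℝ) × ℝ => Function.update z.1 i z.2 := by
    refine measurable_pi_lambda _ fun j => ?_
    by_cases hj : j = i
    · subst hj; simpa using measurable_snd
    · simpa [Function.update_of_ne hj, Function.comp_def] using
        (measurable_pi_apply j).comp measurable_fst
  refine ⟨hmeas, (Measure.pi_eq fun s hs => ?_).symm⟩
  rw [Measure.map_apply hmeas (MeasurableSet.univ_pi hs)]
  have hset : (fun z : (ι → ℝ) × ℝ => Function.update z.1 i z.2) ⁻¹' Set.univ.pi s =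
      (Set.univ.pi (Function.update s i Set.univ)) ×ˢ s i := by
    ext ⟨v, b⟩
    simp only [Set.mem_preimage, Set.mem_univ_pi, Set.mem_prod]
    constructor
    · intro h
      refine ⟨fun j => ?_, by simpa using h i⟩
      by_cases hj : j = i
      · subst hj; simp
      · simpa [Function.update_of_ne hj] using h j
    · rintro ⟨h, hb⟩ j
      by_cases hj : j = i
      · subst hj; simpa using hb
      · simpa [Function.update_of_ne hj] using h j
  rw [hset, Measure.prod_prod, Measure.pi_pi, ← Finset.mul_prod_erase _ _ (Finset.mem_univ i),
    ← Finset.mul_prod_erase _ (fun j => μ j (s j)) (Finset.mem_univ i)]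
  simp only [Function.update_self, measure_univ, one_mul]
  rw [mul_comm]
  congr 1
  exact Finset.prod_congr rfl fun j hj => by
    rw [Function.update_of_ne (Finset.ne_of_mem_erase hj)]

/-- Integrals over a product measure may be compared one coordinate at a time. -/
theorem integral_pi_mono_update {ι : Type*} [Fintype ι] [DecidableEq ι]
    (μ : ι → Measure ℝ) [∀ i, IsProbabilityMeasure (μ i)] (i : ι) {f g : (ι → ℝ) → ℝ}
    (hf : Integrable f (Measure.pi μ)) (hg : Integrable g (Measure.pi μ))
    (h : ∀ᵐ v ∂Measure.pi μ, ∫ b, f (Function.update v i b) ∂μ i ≤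
      ∫ b, g (Function.update v i b) ∂μ i) :
    ∫ v, f v ∂Measure.pi μ ≤ ∫ v, g v ∂Measure.pi μ := by
  have hp := measurePreserving_update_pi μ i
  have key : ∀ k : (ι → ℝ) → ℝ, Integrable k (Measure.pi μ) →
      Integrable (fun z : (ι → ℝ) × ℝ => k (Function.update z.1 i z.2))
        ((Measure.pi μ).prod (μ i)) ∧
      ∫ v, k v ∂Measure.pi μ =
        ∫ v, ∫ b, k (Function.update v i b) ∂μ i ∂Measure.pi μ := by
    intro k hk
    have hi : Integrable (fun z : (ι → ℝ) × ℝ => k (Function.update z.1 i z.2))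
        ((Measure.pi μ).prod (μ i)) := hp.integrable_comp_of_integrable hk
    refine ⟨hi, ?_⟩
    rw [← integral_prod _ hi]
    conv_lhs => rw [← hp.map_eq]
    exact integral_map hp.measurable.aemeasurable (by rw [hp.map_eq]; exact hk.1)
  rw [(key f hf).2, (key g hg).2]
  exact integral_mono_ae (key f hf).1.integral_prod_left (key g hg).1.integral_prod_left h

theorem ae_pi_of_ae {ι : Type*} [Fintype ι] (μ : ι → Measure ℝ)
    [∀ i, IsProbabilityMeasure (μ i)] {P : ι → ℝ → Prop} (h : ∀ i, ∀ᵐ x ∂μ i, P i x) :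
    ∀ᵐ v ∂Measure.pi μ, ∀ i, P i (v i) :=
  Filter.eventually_all.2 fun i =>
    (measurePreserving_eval μ i).quasiMeasurePreserving.ae (h i)

theorem ofReal_integral_le_lintegral_ofReal {α : Type*} [MeasurableSpace α] {μ : Measure α}
    {f : α → ℝ} (hf : Integrable f μ) :
    ENNReal.ofReal (∫ x, f x ∂μ) ≤ ∫⁻ x, ENNReal.ofReal (f x) ∂μ := by
  rw [integral_eq_lintegral_pos_part_sub_lintegral_neg_part hf]
  refine (ENNReal.ofReal_le_ofReal (sub_le_self _ ENNReal.toReal_nonneg)).trans ?_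
  exact ENNReal.ofReal_toReal_le

theorem exists_lex_maximizer {α : Type*} {s : Finset α} (hs : s.Nonempty) (e : α → ℝ)
    {r : α → ℕ} (hr : Function.Injective r) :
    ∃ X, X ∈ s ∧ ∀ Y ∈ s, Y ≠ X → (e Y < e X ∨ (e Y = e X ∧ r X < r Y)) := by
  obtain ⟨M, hM, hmax⟩ := s.exists_max_image e hs
  obtain ⟨X, hX, hmin⟩ := (s.filter fun Y => e Y = e M).exists_min_image r
    ⟨M, by simp [hM]⟩
  rw [Finset.mem_filter] at hX
  refine ⟨X, hX.1, fun Y hY hYX => ?_⟩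
  rcases (hmax Y hY).lt_or_eq with h | h
  · exact Or.inl (h.trans_eq hX.2.symm)
  · refine Or.inr ⟨h.trans hX.2.symm, lt_of_le_of_ne (hmin Y (by simp [hY, h])) fun hr' => ?_⟩
    exact hYX (hr hr').symm

section Levels

variable {n t : ℕ} (A : TLevel n t)

theorem lt_levCount_iff (i : Fin n) (k : Fin t) (b : ℝ) :
    k.val < levCount A i b ↔ A.thr i k ≤ b := by
  constructor
  · intro h
    by_contra hb
    have hsub : (Finset.univ.filter fun τ : Fin t => A.thr i τ ≤ b) ⊆ Finset.Iio k := by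
      intro τ hτ
      rw [Finset.mem_filter] at hτ
      rw [Finset.mem_Iio]
      by_contra hk
      exact hb ((A.mono i (not_lt.1 hk)).trans hτ.2)
    have := Finset.card_le_card hsub
    rw [Fin.card_Iio] at this
    exact absurd h (not_lt.2 this)
  · intro h
    have hsub : Finset.Iic k ⊆ (Finset.univ.filter fun τ : Fin t => A.thr i τ ≤ b) := by
      intro τ hτ
      rw [Finset.mem_Iic] at hτ
      simpa using (A.mono i hτ).trans h
    have := Finset.card_le_card hsub
    rw [Fin.card_Iic] at this
    exact this

theorem levCount_mono (i : Fin n) : Monotone (levCount A i) := fun _ _ h =>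
  Finset.card_le_card (Finset.monotone_filter_right _ fun _ _ hτ => le_trans hτ h)

theorem levCount_le (i : Fin n) (b : ℝ) : levCount A i b ≤ t :=
  (Finset.card_filter_le _ _).trans_eq (Finset.card_fin t)

theorem phiAt_mono {Φ : Fin t → ℝ} (hΦ : Monotone Φ) {c d : ℕ} (hcd : c ≤ d) (hd : d ≤ t) :
    phiAt Φ c ≤ phiAt Φ d := by
  unfold phiAt
  by_cases h : d - 1 < t
  · rw [dif_pos h, dif_pos (by omega)]
    exact hΦ (by simp only [Fin.mk_le_mk]; omega)
  · rw [dif_neg h, dif_neg (by omega)]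

/-- A function of the bidders' levels is integrable. -/
theorem integrable_of_levCount_congr {f : (Fin n → ℝ) → ℝ}
    (hf : ∀ v w, (∀ i, levCount A i (v i) = levCount A i (w i)) → f v = f w)
    (μ : Measure (Fin n → ℝ)) [IsFiniteMeasure μ] : Integrable f μ := by
  let c : (Fin n → ℝ) → Fin n → ℕ := fun v i => levCount A i (v i)
  have hc : Measurable c := measurable_pi_lambda _ fun i =>
    (levCount_mono A i).measurable.comp (measurable_pi_apply i)
  have hfac : f = Function.extend c f 0 ∘ c := by
    funext v
    have : Function.FactorsThrough f c := fun v w h => hf v w (congrFun h)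
    exact (this.extend_apply 0 v).symm
  have hmeas : Measurable f := by
    rw [hfac]
    exact (measurable_of_countable _).comp hc
  have hfin : (Set.range f).Finite := by
    refine ((Set.Finite.pi' fun _ : Fin n => Set.finite_Iic t).image
      (Function.extend c f 0)).subset ?_
    rintro _ ⟨v, rfl⟩
    exact ⟨c v, fun i => levCount_le A i (v i), (congrFun hfac v).symm⟩
  obtain ⟨C, hC⟩ := (hfin.image norm).bddAbove
  exact Integrable.of_bound hmeas.aestronglyMeasurable C
    (Filter.Eventually.of_forall fun v => hC ⟨f v, ⟨v, rfl⟩, rfl⟩)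

variable (Φ : Fin t → ℝ) (𝒳 : Finset (Finset (Fin n)))

theorem selected_congr (ord : Finset (Fin n) → Finset (Fin n) → Prop) {v w : Fin n → ℝ}
    (h : ∀ i, levCount A i (v i) = levCount A i (w i)) :
    selected A Φ 𝒳 ord v = selected A Φ 𝒳 ord w := by
  have he : eSet A Φ v = eSet A Φ w := by
    funext X
    simp only [eSet, h]
  simp only [selected, h, he]

theorem levCount_update_congr {v w : Fin n → ℝ} (i : Fin n) {b b' : ℝ}
    (h : ∀ j, levCount A j (v j) = levCount A j (w j))
    (hb : levCount A i b = levCount A i b') (j : Fin n) :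
    levCount A j (Function.update v i b j) = levCount A j (Function.update w i b' j) := by
  by_cases hj : j = i
  · subst hj; simpa using hb
  · simpa [Function.update_of_ne hj] using h j

theorem payX_congr (ord : Finset (Fin n) → Finset (Fin n) → Prop) {v w : Fin n → ℝ}
    (h : ∀ i, levCount A i (v i) = levCount A i (w i)) (i : Fin n) :
    payX A Φ 𝒳 ord v i = payX A Φ 𝒳 ord w i := by
  unfold payX
  congr 1
  ext b
  simp only [Set.mem_ofPred_eq]
  rw [selected_congr A Φ 𝒳 ord (levCount_update_congr A i h rfl)]

variable {𝒳} {r : Finset (Fin n) → ℕ}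

theorem levCount_ne_zero_of_mem_selected {ord : Finset (Fin n) → Finset (Fin n) → Prop}
    {v : Fin n → ℝ} {i : Fin n} (h : i ∈ selected A Φ 𝒳 ord v) (j : Fin n) :
    levCount A j (v j) ≠ 0 := by
  intro h0
  rw [selected, if_pos ⟨j, h0⟩] at h
  simp at h

theorem selected_spec (h𝒳 : ∅ ∈ 𝒳) (hr : Function.Injective r)
    {v : Fin n → ℝ} (hv : ∀ i, levCount A i (v i) ≠ 0) :
    selected A Φ 𝒳 (fun X Y => r X < r Y) v ∈ 𝒳 ∧
      ∀ Y ∈ 𝒳, Y ≠ selected A Φ 𝒳 (fun X Y => r X < r Y) v →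
        (eSet A Φ v Y < eSet A Φ v (selected A Φ 𝒳 (fun X Y => r X < r Y) v) ∨
          (eSet A Φ v Y = eSet A Φ v (selected A Φ 𝒳 (fun X Y => r X < r Y) v) ∧
            r (selected A Φ 𝒳 (fun X Y => r X < r Y) v) < r Y)) := by
  have hex := exists_lex_maximizer ⟨∅, h𝒳⟩ (eSet A Φ v) hr
  rw [selected, if_neg (by simpa using hv), dif_pos hex]
  exact hex.choose_spec

theorem eSet_le_eSet_selected (h𝒳 : ∅ ∈ 𝒳) (hr : Function.Injective r)
    {v : Fin n → ℝ} (hv : ∀ i, levCount A i (v i) ≠ 0)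
    {Y : Finset (Fin n)} (hY : Y ∈ 𝒳) :
    eSet A Φ v Y ≤ eSet A Φ v (selected A Φ 𝒳 (fun X Y => r X < r Y) v) := by
  by_cases h : Y = selected A Φ 𝒳 (fun X Y => r X < r Y) v
  · rw [← h]
  · rcases (selected_spec A Φ h𝒳 hr hv).2 Y hY h with h | h
    · exact h.le
    · exact h.1.le

/-- The allocation rule of a `t`-level auction is monotone. -/
theorem mem_selected_update_of_le (h𝒳 : ∅ ∈ 𝒳) (hr : Function.Injective r)
    (hΦ : Monotone Φ) {v : Fin n → ℝ} {i : Fin n} {b : ℝ}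
    (h : i ∈ selected A Φ 𝒳 (fun X Y => r X < r Y) v) (hb : v i ≤ b) :
    i ∈ selected A Φ 𝒳 (fun X Y => r X < r Y) (Function.update v i b) := by
  have hv := levCount_ne_zero_of_mem_selected A Φ h
  have hlev := levCount_mono A i hb
  have hw : ∀ j, levCount A j (Function.update v i b j) ≠ 0 := by
    intro j
    by_cases hj : j = i
    · subst hj
      rw [Function.update_self]
      have := hv j
      omega
    · rw [Function.update_of_ne hj]
      exact hv j
  obtain ⟨hX, hXmax⟩ := selected_spec A Φ h𝒳 hr hv
  obtain ⟨hY, hYmax⟩ := selected_spec A Φ h𝒳 hr hw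
  set X := selected A Φ 𝒳 (fun X Y => r X < r Y) v
  set Y := selected A Φ 𝒳 (fun X Y => r X < r Y) (Function.update v i b)
  by_contra hiY
  have hne : X ≠ Y := fun hXY => hiY (hXY ▸ h)
  have eY : eSet A Φ (Function.update v i b) Y = eSet A Φ v Y :=
    Finset.sum_congr rfl fun j hj => by
      rw [Function.update_of_ne (ne_of_mem_of_not_mem hj hiY)]
  have eX : eSet A Φ v X ≤ eSet A Φ (Function.update v i b) X := by
    refine Finset.sum_le_sum fun j _ => phiAt_mono hΦ ?_ (levCount_le A j _)
    by_cases hj : j = i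
    · subst hj; simpa using hlev
    · rw [Function.update_of_ne hj]
  rcases hXmax Y hY hne.symm with h1 | h1 <;> rcases hYmax X hX hne with h2 | h2
  · linarith
  · linarith [h2.1]
  · linarith [h1.1]
  · exact lt_asymm h1.2 h2.2

/-- If bidders at the lowest level never win, then the winning bids of a bidder are those
above one of her higher thresholds. -/
theorem exists_winning_bids_eq_Ici (h𝒳 : ∅ ∈ 𝒳) (hr : Function.Injective r)
    (hΦ : Monotone Φ)
    (hlow : ∀ v i, i ∈ selected A Φ 𝒳 (fun X Y => r X < r Y) v → 1 < levCount A i (v i))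
    {v : Fin n → ℝ} {i : Fin n}
    (hne : ∃ b, i ∈ selected A Φ 𝒳 (fun X Y => r X < r Y) (Function.update v i b)) :
    ∃ k : Fin t, 0 < k.val ∧ ∀ b,
      i ∈ selected A Φ 𝒳 (fun X Y => r X < r Y) (Function.update v i b) ↔
        A.thr i k ≤ b := by
  have hstep : ∀ b, i ∈ selected A Φ 𝒳 (fun X Y => r X < r Y) (Function.update v i b) →
      ∃ k : Fin t, A.thr i k ≤ b ∧ 0 < k.val ∧
        i ∈ selected A Φ 𝒳 (fun X Y => r X < r Y) (Function.update v i (A.thr i k)) := by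
    intro b hb
    have h1 := hlow _ _ hb
    rw [Function.update_self] at h1
    have h2 := levCount_le A i b
    let k : Fin t := ⟨levCount A i b - 1, by omega⟩
    have hkb : A.thr i k ≤ b := (lt_levCount_iff A i k b).1 (by simp only [k]; omega)
    refine ⟨k, hkb, by simp only [k]; omega, ?_⟩
    have h3 := (lt_levCount_iff A i k (A.thr i k)).2 le_rfl
    have h4 := levCount_mono A i hkb
    rw [selected_congr A Φ 𝒳 _ (levCount_update_congr A (w := v) (b' := b) i
      (fun _ => rfl) (by simp only [k] at h3 h4 ⊢; omega))]
    exact hb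
  obtain ⟨b, hb⟩ := hne
  obtain ⟨k, -, hk0, hk⟩ := hstep b hb
  obtain ⟨k, hk, hmin⟩ := (Finset.univ.filter fun k : Fin t => 0 < k.val ∧
    i ∈ selected A Φ 𝒳 (fun X Y => r X < r Y)
      (Function.update v i (A.thr i k))).exists_min_image id ⟨k, by simp [hk0, hk]⟩
  rw [Finset.mem_filter] at hk
  refine ⟨k, hk.2.1, fun b => ⟨fun hb => ?_, fun hb => ?_⟩⟩
  · obtain ⟨k', hk'b, hk'⟩ := hstep b hb
    exact (A.mono i (hmin k' (by simpa using hk'))).trans hk'b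
  · have := mem_selected_update_of_le A Φ h𝒳 hr hΦ hk.2.2 (b := b) (by simpa using hb)
    rwa [Function.update_idem] at this

/-- The expected payment of a bidder in a `t`-level auction is at least her expected
contribution to the objective, if this holds for posted prices at her thresholds. -/
theorem integral_phiAt_le_integral_payX (h𝒳 : ∅ ∈ 𝒳) (hr : Function.Injective r)
    (hΦ : Monotone Φ)
    (hlow : ∀ v i, i ∈ selected A Φ 𝒳 (fun X Y => r X < r Y) v → 1 < levCount A i (v i))
    (μ : Measure ℝ) {i : Fin n}
    (hμ : ∀ k : Fin t, 0 < k.val →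
      ∫ b, (Set.Ici (A.thr i k)).indicator (fun b => phiAt Φ (levCount A i b)) b ∂μ ≤
        A.thr i k * μ.real (Set.Ici (A.thr i k)))
    (v : Fin n → ℝ) :
    ∫ b, (if i ∈ selected A Φ 𝒳 (fun X Y => r X < r Y) (Function.update v i b)
        then phiAt Φ (levCount A i (Function.update v i b i)) else 0) ∂μ ≤
      ∫ b, (if i ∈ selected A Φ 𝒳 (fun X Y => r X < r Y) (Function.update v i b)
        then payX A Φ 𝒳 (fun X Y => r X < r Y) (Function.update v i b) i else 0) ∂μ := by
  by_cases hne : ∃ b, i ∈ selected A Φ 𝒳 (fun X Y => r X < r Y) (Function.update v i b)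
  · obtain ⟨k, hk0, hk⟩ := exists_winning_bids_eq_Ici A Φ h𝒳 hr hΦ hlow hne
    have hpay : ∀ b, payX A Φ 𝒳 (fun X Y => r X < r Y) (Function.update v i b) i =
        A.thr i k := by
      intro b
      simp only [payX, Function.update_idem, hk]
      exact csInf_Ici
    simp only [hk, hpay, Function.update_self]
    have h2 : ∫ b, (if A.thr i k ≤ b then A.thr i k else 0) ∂μ =
        A.thr i k * μ.real (Set.Ici (A.thr i k)) := by
      have : (fun b => if A.thr i k ≤ b then A.thr i k else 0) =
          (Set.Ici (A.thr i k)).indicator fun _ => A.thr i k := by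
        funext b
        simp [Set.indicator]
      rw [this, integral_indicator measurableSet_Ici]
      simp [mul_comm]
    rw [h2]
    refine le_of_eq_of_le (integral_congr_ae (Filter.Eventually.of_forall fun b => ?_))
      (hμ k hk0)
    simp [Set.indicator]
  · have : ∀ b, i ∉ selected A Φ 𝒳 (fun X Y => r X < r Y) (Function.update v i b) :=
      not_exists.1 hne
    simp [this]

end Levels

/-- The expected payment of a bidder in a DSIC-IR auction, given the other bids, is bounded by
the expectation of any function dominating the revenue of every posted price. -/
theorem integral_pay_update_le {n : ℕ} {𝒳 : Finset (Finset (Fin n))} {H : ℝ}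
    (B : XDSICAuction n 𝒳 (Set.Icc 0 H)) {i : Fin n} (μ : Measure ℝ) [IsProbabilityMeasure μ]
    [NullSingletonClass μ] (hsupp : ∀ᵐ b ∂μ, b ∈ Set.Icc 0 H) {g : ℝ → ℝ}
    (hg : ∀ p ≤ H, 0 ≤ p → p * μ.real (Set.Ici p) ≤ ∫ b, (Set.Ici p).indicator g b ∂μ)
    {v : Fin n → ℝ} (hv : ∀ j, v j ∈ Set.Icc 0 H) :
    ∫ b, B.pay (Function.update v i b) i ∂μ ≤
      ∫ b, (if i ∈ B.choice (Function.update v i b) then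
        g (Function.update v i b i) else 0) ∂μ := by
  have hu : ∀ b ∈ Set.Icc 0 H, ∀ j, Function.update v i b j ∈ Set.Icc 0 H := by
    intro b hb j
    by_cases hj : j = i
    · subst hj; simpa using hb
    · simpa [Function.update_of_ne hj] using hv j
  have hdsic : ∀ b ∈ Set.Icc 0 H, ∀ b' ∈ Set.Icc 0 H,
      b * (if i ∈ B.choice (Function.update v i b') then 1 else 0) -
        B.pay (Function.update v i b') i ≤
      b * (if i ∈ B.choice (Function.update v i b) then 1 else 0) -
        B.pay (Function.update v i b) i := by
    intro b hb b' hb'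
    have := B.dsic (Function.update v i b) (hu b hb) i b' hb'
    rwa [Function.update_idem, Function.update_self] at this
  have hle : ∀ b ∈ Set.Icc 0 H, B.pay (Function.update v i b) i ≤
      b * (if i ∈ B.choice (Function.update v i b) then 1 else 0) := by
    intro b hb
    have := B.pay_le (Function.update v i b) (hu b hb) i
    rwa [Function.update_self] at this
  have hlose : ∀ b ∈ Set.Icc 0 H, i ∉ B.choice (Function.update v i b) →
      B.pay (Function.update v i b) i = 0 := by
    intro b hb h
    have := hle b hb
    rw [if_neg h, mul_zero] at this
    exact le_antisymm this (B.pay_nonneg _ _)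
  simp only [Function.update_self]
  set W : Set ℝ := {b | b ∈ Set.Icc 0 H ∧ i ∈ B.choice (Function.update v i b)}
  have hup : ∀ b ∈ W, ∀ b' ∈ Set.Icc 0 H, b < b' → b' ∈ W := by
    intro b hb b' hb' hlt
    refine ⟨hb', by_contra fun h => ?_⟩
    have h1 := hdsic b' hb' b hb.1
    have h2 := hle b hb.1
    rw [if_pos hb.2, if_neg h, hlose b' hb' h] at h1
    rw [if_pos hb.2] at h2
    linarith
  have hpay : ∀ b ∈ W, ∀ b' ∈ W, B.pay (Function.update v i b) i ≤ b' := by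
    intro b hb b' hb'
    have h1 := hdsic b hb.1 b' hb'.1
    have h2 := hle b' hb'.1
    rw [if_pos hb.2, if_pos hb'.2] at h1
    rw [if_pos hb'.2] at h2
    linarith
  have hbdd : BddBelow W := ⟨0, fun b hb => hb.1.1⟩
  rcases W.eq_empty_or_nonempty with hW | hW
  · have hnot : ∀ b ∈ Set.Icc 0 H, i ∉ B.choice (Function.update v i b) := by
      intro b hb h
      have : b ∈ W := ⟨hb, h⟩
      simp [hW] at this
    refine le_of_eq (integral_congr_ae ?_)
    filter_upwards [hsupp] with b hb
    rw [hlose b hb (hnot b hb), if_neg (hnot b hb)]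
  · set p := sInf W
    have hp0 : 0 ≤ p := le_csInf hW fun b hb => hb.1.1
    have hpH : p ≤ H := by
      obtain ⟨b, hb⟩ := hW
      exact (csInf_le hbdd hb).trans hb.1.2
    have hiff : ∀ᵐ b ∂μ, b ∈ Set.Icc 0 H ∧
        (i ∈ B.choice (Function.update v i b) ↔ b ∈ Set.Ici p) := by
      have hne : ∀ᵐ b ∂μ, b ≠ p := by simp [ae_iff]
      filter_upwards [hsupp, hne] with b hb hbp
      refine ⟨hb, fun h => csInf_le hbdd ⟨hb, h⟩, fun h => ?_⟩
      obtain ⟨w, hw, hwb⟩ := exists_lt_of_csInf_lt hW (lt_of_le_of_ne h hbp.symm)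
      exact (hup w hw b hb hwb).2
    calc ∫ b, B.pay (Function.update v i b) i ∂μ
        ≤ ∫ b, (Set.Ici p).indicator (fun _ => p) b ∂μ := by
          refine integral_mono_of_nonneg
            (Filter.Eventually.of_forall fun b => B.pay_nonneg _ _)
            ((integrable_const p).indicator measurableSet_Ici) ?_
          filter_upwards [hiff] with b hb
          by_cases h : i ∈ B.choice (Function.update v i b)
          · rw [Set.indicator_of_mem (hb.2.1 h)]
            exact le_csInf hW fun b' hb' => hpay b ⟨hb.1, h⟩ b' hb'
          · rw [Set.indicator_of_notMem fun h' => h (hb.2.2 h'), hlose b hb.1 h]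
      _ = p * μ.real (Set.Ici p) := by
          rw [integral_indicator measurableSet_Ici]
          simp [mul_comm]
      _ ≤ ∫ b, (Set.Ici p).indicator g b ∂μ := hg p hpH hp0
      _ = _ := by
          refine integral_congr_ae ?_
          filter_upwards [hiff] with b hb
          by_cases h : b ∈ Set.Ici p
          · rw [Set.indicator_of_mem h, if_pos (hb.2.2 h)]
          · rw [Set.indicator_of_notMem h, if_neg fun h' => h (hb.2.1 h')]

section AffineEstimates

variable {n m : ℕ} (A : TLevel n (m + 1)) {Φ : Fin (m + 1) → ℝ} {a δ : ℝ}

theorem phiAt_of_affine (hΦ : ∀ k, Φ k = a + (k : ℕ) * δ) {c : ℕ} (hc : c ≤ m + 1) :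
    phiAt Φ c = a + (c - 1 : ℕ) * δ := by
  rw [phiAt, dif_pos (by omega), hΦ]

variable {L : ℕ → ℝ} {i : Fin n}

theorem levCount_eq_one_add_sum
    (hA : ∀ k, A.thr i k = if (k : ℕ) = 0 then 0 else L k) {b : ℝ} (hb : 0 ≤ b) :
    levCount A i b = 1 + ∑ k ∈ Finset.Ioc 0 m, if L k ≤ b then 1 else 0 := by
  rw [levCount, Finset.card_filter, Fin.sum_univ_succ]
  have h0 : A.thr i 0 ≤ b := by simpa [hA] using hb
  rw [if_pos h0]
  congr 1
  have hIoc : Finset.Ioc 0 m = (Finset.range m).map (addRightEmbedding 1) := by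
    ext k
    simp only [Finset.mem_Ioc, Finset.mem_map, Finset.mem_range, addRightEmbedding_apply]
    exact ⟨fun h => ⟨k - 1, by omega, by omega⟩, by rintro ⟨j, h1, rfl⟩; omega⟩
  rw [hIoc, Finset.sum_map, ← Fin.sum_univ_eq_sum_range
    (fun k => if L (addRightEmbedding 1 k) ≤ b then 1 else 0)]
  refine Finset.sum_congr rfl fun k _ => ?_
  simp [hA]

theorem integrable_phiAt_levCount {t : ℕ} (A : TLevel n t) (Φ : Fin t → ℝ) (i : Fin n)
    (μ : Measure ℝ) [IsFiniteMeasure μ] :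
    Integrable (fun b => phiAt Φ (levCount A i b)) μ := by
  refine Integrable.of_bound (C := ∑ c ∈ Finset.range (t + 1), ‖phiAt Φ c‖)
    ((measurable_of_countable (phiAt Φ)).comp
      (levCount_mono A i).measurable).aestronglyMeasurable
    (Filter.Eventually.of_forall fun b => ?_)
  exact Finset.single_le_sum (f := fun c => ‖phiAt Φ c‖) (fun _ _ => norm_nonneg _)
    (Finset.mem_range.2 (Nat.lt_succ_of_le (levCount_le A i b)))

theorem integral_indicator_Ici_phiAt (hΦ : ∀ k, Φ k = a + (k : ℕ) * δ)
    (hA : ∀ k, A.thr i k = if (k : ℕ) = 0 then 0 else L k) (μ : Measure ℝ)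
    [IsProbabilityMeasure μ] {p : ℝ} (hp : 0 ≤ p) :
    ∫ b, (Set.Ici p).indicator (fun b => phiAt Φ (levCount A i b)) b ∂μ =
      a * μ.real (Set.Ici p) +
        δ * ∑ k ∈ Finset.Ioc 0 m, μ.real (Set.Ici (max p (L k))) := by
  have hpt : ∀ b, (Set.Ici p).indicator (fun b => phiAt Φ (levCount A i b)) b =
      (Set.Ici p).indicator (fun _ => a) b +
        ∑ k ∈ Finset.Ioc 0 m, (Set.Ici (max p (L k))).indicator (fun _ => δ) b := by
    intro b
    by_cases hb : p ≤ b
    · rw [Set.indicator_of_mem (Set.mem_Ici.2 hb), Set.indicator_of_mem (Set.mem_Ici.2 hb),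
        phiAt_of_affine hΦ (levCount_le A i b), levCount_eq_one_add_sum A hA (hp.trans hb)]
      simp [Set.indicator, hb, Finset.sum_ite]
    · simp [Set.indicator, hb]
  have hint : ∀ (q d : ℝ), Integrable ((Set.Ici q).indicator fun _ => d) μ := fun q d =>
    (integrable_const d).indicator measurableSet_Ici
  have hval : ∀ (q d : ℝ), ∫ b, (Set.Ici q).indicator (fun _ => d) b ∂μ =
      d * μ.real (Set.Ici q) := by
    intro q d
    rw [integral_indicator measurableSet_Ici]
    simp [mul_comm]
  simp only [hpt]
  rw [integral_add (hint _ _) (integrable_finsetSum _ fun k _ => hint _ _),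
    integral_finsetSum _ fun k _ => hint _ _, Finset.mul_sum]
  simp only [hval]

/-- With the lowest estimate below `-(n - 1) * H`, a bidder at the lowest level never wins. -/
theorem one_lt_levCount_of_mem_selected {𝒳 : Finset (Finset (Fin n))} (h𝒳 : ∅ ∈ 𝒳)
    {r : Finset (Fin n) → ℕ} (hr : Function.Injective r) {H : ℝ} (hH : 0 < H) (hδ : 0 ≤ δ)
    (hΦ : ∀ k, Φ k = -(n * H) + (k : ℕ) * δ) (hm : m * δ = (n + 1) * H)
    (v : Fin n → ℝ) (i : Fin n) (h : i ∈ selected A Φ 𝒳 (fun X Y => r X < r Y) v) :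
    1 < levCount A i (v i) := by
  have hv := levCount_ne_zero_of_mem_selected A Φ h
  by_contra hle
  have h1 : levCount A i (v i) = 1 := by have := hv i; omega
  have hempty := eSet_le_eSet_selected A Φ h𝒳 hr hv h𝒳
  set X := selected A Φ 𝒳 (fun X Y => r X < r Y) v
  have hi : phiAt Φ (levCount A i (v i)) = -(n * H) := by
    rw [phiAt_of_affine hΦ (levCount_le A i _), h1]
    simp
  have hub : ∀ j, phiAt Φ (levCount A j (v j)) ≤ H := by
    intro j
    rw [phiAt_of_affine hΦ (levCount_le A j _)]
    have h2 : ((levCount A j (v j) - 1 : ℕ) : ℝ) ≤ m := by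
      have := levCount_le A j (v j)
      exact_mod_cast (by omega : levCount A j (v j) - 1 ≤ m)
    nlinarith [mul_le_mul_of_nonneg_right h2 hδ]
  have hsum : eSet A Φ v X ≤ -(n * H) + (X.erase i).card * H := by
    rw [eSet, ← Finset.add_sum_erase _ _ h, hi]
    have := Finset.sum_le_card_nsmul (X.erase i)
      (fun j => phiAt Φ (levCount A j (v j))) H fun j _ => hub j
    rw [nsmul_eq_mul] at this
    linarith
  have hcard : ((X.erase i).card : ℝ) + 1 ≤ n := by
    have h3 := Finset.card_le_univ X
    rw [Fintype.card_fin] at h3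
    have h4 := Finset.card_erase_add_one h
    exact_mod_cast h4.trans_le h3
  have h0 : eSet A Φ v ∅ = 0 := by simp [eSet]
  nlinarith [mul_le_mul_of_nonneg_right hcard hH.le]

end AffineEstimates

section Optimum

variable {n : ℕ} {𝒳 : Finset (Finset (Fin n))} {H : ℝ}

theorem XDSICAuction.pay_le_of_mem (B : XDSICAuction n 𝒳 (Set.Icc 0 H)) {v : Fin n → ℝ}
    (hv : ∀ j, v j ∈ Set.Icc 0 H) (i : Fin n) : B.pay v i ≤ H := by
  refine (B.pay_le v hv i).trans ?_
  split_ifs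
  · simpa using (hv i).2
  · simpa using (hv i).1.trans (hv i).2

theorem OPTX_le_of_integral_le {μ : Measure (Fin n → ℝ)} [IsProbabilityMeasure μ]
    (hsupp : ∀ᵐ v ∂μ, ∀ j, v j ∈ Set.Icc 0 H) {R : ℝ}
    (h : ∀ B : XDSICAuction n 𝒳 (Set.Icc 0 H),
      (∀ i, Integrable (fun v => B.pay v i) μ) → ∑ i, ∫ v, B.pay v i ∂μ ≤ R) :
    OPTX n 𝒳 (Set.Icc 0 H) μ ≤ ENNReal.ofReal R := by
  refine iSup_le fun B => ?_
  have hint : ∀ i, Integrable (fun v => B.pay v i) μ := by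
    intro i
    refine Integrable.of_bound (B.pay_meas i).aestronglyMeasurable H ?_
    filter_upwards [hsupp] with v hv
    rw [Real.norm_of_nonneg (B.pay_nonneg v i)]
    exact B.pay_le_of_mem hv i
  have heq : ∀ v, ∑ i, ENNReal.ofReal (B.pay v i) = ENNReal.ofReal (∑ i, B.pay v i) :=
    fun v => (ENNReal.ofReal_sum_of_nonneg fun i _ => B.pay_nonneg v i).symm
  simp only [heq]
  rw [← ofReal_integral_eq_lintegral_ofReal (integrable_finsetSum _ fun i _ => hint i)
    (Filter.Eventually.of_forall fun v => Finset.sum_nonneg fun i _ => B.pay_nonneg v i),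
    integral_finsetSum _ fun i _ => hint i]
  exact ENNReal.ofReal_le_ofReal (h B hint)

theorem OPTX_le_card_mul {μ : Measure (Fin n → ℝ)} [IsProbabilityMeasure μ]
    (hsupp : ∀ᵐ v ∂μ, ∀ j, v j ∈ Set.Icc 0 H) :
    OPTX n 𝒳 (Set.Icc 0 H) μ ≤ ENNReal.ofReal (n * H) := by
  refine OPTX_le_of_integral_le hsupp fun B hint => ?_
  have : ∀ i ∈ Finset.univ, ∫ v, B.pay v i ∂μ ≤ H := by
    intro i _
    have := integral_mono_ae (hint i) (integrable_const H)
      (hsupp.mono fun v hv => B.pay_le_of_mem hv i)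
    simpa using this
  simpa using Finset.sum_le_card_nsmul _ _ _ this

end Optimum

/-- The auction using, for each bidder, the optimal posted prices against the costs
`-n * H + k * δ` loses at most `n * δ` compared to the optimal auction. -/
theorem exists_tlevel_OPTX_le {n m : ℕ} {H δ : ℝ} (hH : 0 < H) (hδ : 0 ≤ δ) (hm : 1 ≤ m)
    (hmδ : m * δ = (n + 1) * H) {𝒳 : Finset (Finset (Fin n))} (h𝒳 : ∅ ∈ 𝒳)
    {r : Finset (Fin n) → ℕ} (hr : Function.Injective r) (F : Fin n → Measure ℝ)
    [∀ i, IsProbabilityMeasure (F i)] [∀ i, NullSingletonClass (F i)]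
    (hF : ∀ i, ∀ᵐ b ∂F i, b ∈ Set.Icc 0 H) :
    ∃ (Φ : Fin (m + 1) → ℝ) (A : TLevel n (m + 1)), Monotone Φ ∧
      OPTX n 𝒳 (Set.Icc 0 H) (Measure.pi F) ≤
        (∫⁻ v, ENNReal.ofReal (RevX A Φ 𝒳 (fun X Y => r X < r Y) v) ∂(Measure.pi F)) +
          ENNReal.ofReal (n * δ) := by
  have hladder := fun i => exists_price_ladder (continuous_measureReal_Ici (F i))
    (fun p q hpq => measureReal_mono (Set.Ici_subset_Ici.2 hpq))
    (fun _ => measureReal_nonneg) hδ hH.le hm (a := -(n * H)) (H := H)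
    (by linarith)
  choose L hLmono hL hlow hup using hladder
  let A : TLevel n (m + 1) :=
    { thr := fun i k => if (k : ℕ) = 0 then 0 else L i k
      mono := by
        intro i j k hjk
        have hjk' : (j : ℕ) ≤ k := hjk
        by_cases hj : (j : ℕ) = 0
        · by_cases hk : (k : ℕ) = 0
          · simp [hj, hk]
          · simpa [hj, hk] using (hL i k).1
        · have hk : (k : ℕ) ≠ 0 := by omega
          simpa [hj, hk] using hLmono i hjk' }
  let Φ : Fin (m + 1) → ℝ := fun k => -(n * H) + (k : ℕ) * δ
  have hΦ : ∀ k, Φ k = -(n * H) + (k : ℕ) * δ := fun _ => rfl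
  have hA : ∀ i k, A.thr i k = if (k : ℕ) = 0 then 0 else L i k := fun _ _ => rfl
  have hΦmono : Monotone Φ := fun j k hjk => by
    have : ((j : ℕ) : ℝ) ≤ (k : ℕ) := by exact_mod_cast hjk
    simp only [hΦ]
    nlinarith [mul_le_mul_of_nonneg_right this hδ]
  refine ⟨Φ, A, hΦmono, ?_⟩
  have hsupp := ae_pi_of_ae F hF
  set ord : Finset (Fin n) → Finset (Fin n) → Prop := fun X Y => r X < r Y
  let φ : Fin n → ℝ → ℝ := fun i b => phiAt Φ (levCount A i b)
  have hwin := one_lt_levCount_of_mem_selected A h𝒳 hr hH hδ hΦ hmδ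
  have hpos : ∀ v : Fin n → ℝ, (∀ j, v j ∈ Set.Icc 0 H) → ∀ i, levCount A i (v i) ≠ 0 := by
    intro v hv i
    rw [levCount_eq_one_add_sum A (hA i) (hv i).1]
    omega
  have hsel : ∀ i, Integrable
      (fun v => if i ∈ selected A Φ 𝒳 ord v then φ i (v i) else 0) (Measure.pi F) :=
    fun i => integrable_of_levCount_congr A (fun v w h => by
      simp only [selected_congr A Φ 𝒳 ord h, φ, h i]) _
  have hpayi : ∀ i, Integrable
      (fun v => if i ∈ selected A Φ 𝒳 ord v then payX A Φ 𝒳 ord v i else 0)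
      (Measure.pi F) :=
    fun i => integrable_of_levCount_congr A (fun v w h => by
      simp only [selected_congr A Φ 𝒳 ord h, payX_congr A Φ 𝒳 ord h i]) _
  have hRev : ∀ v, RevX A Φ 𝒳 ord v =
      ∑ i, if i ∈ selected A Φ 𝒳 ord v then payX A Φ 𝒳 ord v i else 0 := by
    intro v
    simp [RevX, Finset.sum_ite_mem]
  have hRevInt : Integrable (RevX A Φ 𝒳 ord) (Measure.pi F) := by
    rw [funext hRev]
    exact integrable_finsetSum _ fun i _ => hpayi i
  have hφpay : ∀ i,
      ∫ v, (if i ∈ selected A Φ 𝒳 ord v then φ i (v i) else 0) ∂Measure.pi F ≤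
      ∫ v, (if i ∈ selected A Φ 𝒳 ord v then payX A Φ 𝒳 ord v i else 0) ∂Measure.pi F := by
    intro i
    refine integral_pi_mono_update F i (hsel i) (hpayi i)
      (Filter.Eventually.of_forall fun v => ?_)
    refine integral_phiAt_le_integral_payX A Φ h𝒳 hr hΦmono hwin (F i) (fun k hk => ?_) v
    have hthr : A.thr i k = L i k := by rw [hA, if_neg hk.ne']
    rw [hthr, integral_indicator_Ici_phiAt A hΦ (hA i) (F i) (hL i k).1]
    exact hlow i k (by omega)
  have hmain : OPTX n 𝒳 (Set.Icc 0 H) (Measure.pi F) ≤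
      ENNReal.ofReal (∫ v, RevX A Φ 𝒳 ord v ∂Measure.pi F + n * δ) := by
    refine OPTX_le_of_integral_le hsupp fun B hint => ?_
    have hch : ∀ i, Integrable
        (fun v => if i ∈ B.choice v then φ i (v i) + δ else 0) (Measure.pi F) := by
      intro i
      have hmeas : MeasurableSet {v | i ∈ B.choice v} := by
        have : {v | i ∈ B.choice v} =
            ⋃ X ∈ (Finset.univ.filter fun X : Finset (Fin n) => i ∈ X),
              {v | B.choice v = X} := by
          ext v
          simp
        rw [this]
        exact Finset.measurableSet_biUnion _ fun X _ => B.choice_meas X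
      have hi : Integrable (fun v : Fin n → ℝ => φ i (v i) + δ) (Measure.pi F) :=
        integrable_of_levCount_congr A (fun v w h => by simp only [φ, h i]) _
      refine (hi.indicator hmeas).congr (Filter.Eventually.of_forall fun v => ?_)
      simp [Set.indicator]
    have hpay : ∀ i, ∫ v, B.pay v i ∂Measure.pi F ≤
        ∫ v, (if i ∈ B.choice v then φ i (v i) + δ else 0) ∂Measure.pi F := by
      intro i
      refine integral_pi_mono_update F i (hint i) (hch i) ?_
      filter_upwards [hsupp] with v hv
      refine integral_pay_update_le B (F i) (hF i) (g := fun b => φ i b + δ)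
        (fun p hpH hp0 => ?_) hv
      have hsplit : (Set.Ici p).indicator (fun b => φ i b + δ) =
          fun b => (Set.Ici p).indicator (φ i) b + (Set.Ici p).indicator (fun _ => δ) b := by
        funext b
        exact congrFun (Set.indicator_add _ _ _) b
      rw [hsplit, integral_add
        ((integrable_phiAt_levCount A Φ i (F i)).indicator measurableSet_Ici)
        ((integrable_const δ).indicator measurableSet_Ici),
        integral_indicator_Ici_phiAt A hΦ (hA i) (F i) hp0,
        integral_indicator measurableSet_Ici]
      have := hup i p hpH hp0
      simp only [integral_const, measureReal_restrict_apply_univ, smul_eq_mul]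
      linarith
    have hpt : ∀ v : Fin n → ℝ, (∀ j, v j ∈ Set.Icc 0 H) →
        ∑ i, (if i ∈ B.choice v then φ i (v i) + δ else 0) ≤
          ∑ i, (if i ∈ selected A Φ 𝒳 ord v then φ i (v i) else 0) + n * δ := by
      intro v hv
      have h1 := eSet_le_eSet_selected A Φ h𝒳 hr (hpos v hv) (B.choice_mem v)
      have h2 : ((B.choice v).card : ℝ) ≤ n := by
        exact_mod_cast (Finset.card_le_univ _).trans_eq (Fintype.card_fin n)
      have h3 := mul_le_mul_of_nonneg_right h2 hδ
      simp only [eSet] at h1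
      simp only [Finset.sum_ite_mem, Finset.univ_inter, Finset.sum_add_distrib,
        Finset.sum_const, nsmul_eq_mul]
      exact add_le_add h1 h3
    calc ∑ i, ∫ v, B.pay v i ∂Measure.pi F
        ≤ ∑ i, ∫ v, (if i ∈ B.choice v then φ i (v i) + δ else 0) ∂Measure.pi F :=
          Finset.sum_le_sum fun i _ => hpay i
      _ = ∫ v, ∑ i, (if i ∈ B.choice v then φ i (v i) + δ else 0) ∂Measure.pi F :=
          (integral_finsetSum _ fun i _ => hch i).symm
      _ ≤ ∫ v, (∑ i, (if i ∈ selected A Φ 𝒳 ord v then φ i (v i) else 0) + n * δ)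
            ∂Measure.pi F :=
          integral_mono_ae (integrable_finsetSum _ fun i _ => hch i)
            ((integrable_finsetSum _ fun i _ => hsel i).add (integrable_const _))
            (hsupp.mono hpt)
      _ = ∑ i, ∫ v, (if i ∈ selected A Φ 𝒳 ord v then φ i (v i) else 0) ∂Measure.pi F +
            n * δ := by
          rw [integral_add (integrable_finsetSum _ fun i _ => hsel i) (integrable_const _),
            integral_finsetSum _ fun i _ => hsel i]
          simp
      _ ≤ ∑ i, ∫ v, (if i ∈ selected A Φ 𝒳 ord v then payX A Φ 𝒳 ord v i else 0)
            ∂Measure.pi F + n * δ := by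
          exact add_le_add_left (Finset.sum_le_sum fun i _ => hφpay i) _
      _ = ∫ v, RevX A Φ 𝒳 ord v ∂Measure.pi F + n * δ := by
          rw [← integral_finsetSum _ fun i _ => hpayi i, ← funext hRev]
  exact hmain.trans (ENNReal.ofReal_add_le.trans
    (add_le_add (ofReal_integral_le_lintegral_ofReal hRevInt) le_rfl))

/-- Representation error of `t`-level auctions in arbitrary single-parameter settings
with `∅` feasible: there is a universal constant `c > 0` such that for valuations from
a product distribution with atomless marginals supported in `[0,H]` and every
`t ≥ c·H·n²/ε`, there are estimates `Φ`, a tie-breaking order, and thresholds whose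
`t`-level auction earns expected revenue within an additive `ε` of optimal. -/
theorem representation_error_tlevel_single_parameter :
    ∃ c : ℝ, 0 < c ∧
      ∀ n : ℕ, 1 ≤ n →
      ∀ H : ℝ, 0 < H →
      ∀ ε : ℝ, ε ∈ Set.Ioo (0 : ℝ) 1 →
      ∀ 𝒳 : Finset (Finset (Fin n)), ∅ ∈ 𝒳 →
      ∀ Fi : Fin n → Measure ℝ,
        (∀ i, IsProbabilityMeasure (Fi i)) →
        (∀ i, ∀ x : ℝ, Fi i {x} = 0) →
        (∀ i, Fi i (Set.Icc 0 H) = 1) →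
      ∀ t : ℕ, c * H * n ^ 2 / ε ≤ t →
      ∃ (Φ : Fin t → ℝ) (ord : Finset (Fin n) → Finset (Fin n) → Prop)
        (A : TLevel n t), Monotone Φ ∧ StrictTotalOn 𝒳 ord ∧
        OPTX n 𝒳 (Set.Icc 0 H) (Measure.pi Fi) ≤
          (∫⁻ v, ENNReal.ofReal (RevX A Φ 𝒳 ord v) ∂(Measure.pi Fi)) +
            ENNReal.ofReal ε := by
  refine ⟨4, by norm_num, ?_⟩
  intro n hn H hH ε hε 𝒳 h𝒳 F hprob hatom hsupp t ht
  have hε0 : 0 < ε := hε.1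
  have : ∀ i, NullSingletonClass (F i) := fun i => ⟨hatom i⟩
  have hF : ∀ i, ∀ᵐ b ∂F i, b ∈ Set.Icc 0 H := fun i =>
    (mem_ae_iff_prob_eq_one measurableSet_Icc).2 (hsupp i)
  let r : Finset (Fin n) → ℕ := fun X => Fintype.equivFin _ X
  have hr : Function.Injective r :=
    Fin.val_injective.comp (Fintype.equivFin (Finset (Fin n))).injective
  have hord : StrictTotalOn 𝒳 (fun X Y => r X < r Y) :=
    ⟨fun _ _ => lt_irrefl _, fun _ _ _ _ _ _ => lt_trans,
      fun _ _ _ _ hXY => lt_or_gt_of_ne (hr.ne hXY)⟩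
  have hn' : (1 : ℝ) ≤ n := by exact_mod_cast hn
  rw [div_le_iff₀ hε0] at ht
  obtain ht1 | ⟨m, hm, rfl⟩ : t ≤ 1 ∨ ∃ m, 1 ≤ m ∧ t = m + 1 := by
    rcases le_or_gt t 1 with h | h
    · exact Or.inl h
    · exact Or.inr ⟨t - 1, by omega, by omega⟩
  · refine ⟨fun _ => 0, _, ⟨fun _ _ => 0, fun _ => monotone_const⟩, monotone_const, hord, ?_⟩
    refine (OPTX_le_card_mul (ae_pi_of_ae F hF)).trans (le_add_left ?_)
    refine ENNReal.ofReal_le_ofReal ?_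
    have h1 : (t : ℝ) ≤ 1 := by exact_mod_cast ht1
    nlinarith [mul_le_mul_of_nonneg_right h1 hε0.le, mul_pos hH (by linarith : (0 : ℝ) < n),
      mul_nonneg (mul_nonneg hH.le (by linarith : (0 : ℝ) ≤ n)) (sub_nonneg.2 hn')]
  · have hm' : (1 : ℝ) ≤ m := by exact_mod_cast hm
    have hm0 : (0 : ℝ) < m := by linarith
    obtain ⟨Φ, A, hΦ, hA⟩ := exists_tlevel_OPTX_le (n := n) (m := m) (δ := (n + 1) * H / m)
      hH (by positivity) hm (by field_simp) h𝒳 hr F hF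
    refine ⟨Φ, _, A, hΦ, hord, hA.trans ?_⟩
    gcongr
    rw [← mul_div_assoc, div_le_iff₀ hm0]
    push_cast at ht
    nlinarith [mul_le_mul_of_nonneg_right hm' hε0.le,
      mul_nonneg (mul_nonneg hH.le (by linarith : (0 : ℝ) ≤ n)) (sub_nonneg.2 hn')]
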